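/- Assume σ_1 < σ_2, I_1 ∩ I_2 ≠ ∅, σ_2 ∉ I_1 ∩ I_2 and χ_2^N − χ_2^S ∉ I_1 ∩ I_2. Then on the closed interval [σ_1, χ_1^N + χ_1^S]: the quantities g_2(σ), h_1(σ), h_2(σ) and (χ_2^S)² − (σ − χ_2^N)² never vanish, the function G is continuous and nonnegative, G(σ_1) = 0, G(σ) > 0 for σ_1 < σ < χ_1^N + χ_1^S, and G attains a finite maximum λ* > 0 on [σ_1, χ_1^N + χ_1^S]. -/

import Mathlib

/-- The function `g_i(σ) = (σ − χ^N) + χ^S·σ/√(σ² + 4αD_S)`. -/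
noncomputable def gFun (χN χS α DS σ : ℝ) : ℝ :=
  (σ - χN) + χS * σ / Real.sqrt (σ ^ 2 + 4 * α * DS)

/-- The function `h_i(σ) = (−σ − s(σ) − 2D_S·λ_i⁻)(−σ + s(σ) − 2D_S·λ_i⁺)` with
`s(σ) = √(σ² + 4αD_S)`, `λ⁻ = (χ^N + χ^S − σ)/D`, `λ⁺ = (χ^N − χ^S − σ)/D`. -/
noncomputable def hFun (χN χS α DS D σ : ℝ) : ℝ :=
  (-σ - Real.sqrt (σ ^ 2 + 4 * α * DS) - 2 * DS * ((χN + χS - σ) / D)) *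
    (-σ + Real.sqrt (σ ^ 2 + 4 * α * DS) - 2 * DS * ((χN - χS - σ) / D))

/-- The function
`G(σ) = −(χ_2^S D_2/(χ_1^S D_1))·(g_1(σ)/g_2(σ))·(h_2(σ)/h_1(σ))
         ·((χ_1^S)² − (χ_1^N − σ)²)/((χ_2^S)² − (χ_2^N − σ)²)`. -/
noncomputable def GFun (χ1N χ1S χ2N χ2S D1 D2 α DS σ : ℝ) : ℝ :=
  -(χ2S * D2 / (χ1S * D1)) * (gFun χ1N χ1S α DS σ / gFun χ2N χ2S α DS σ) *
    (hFun χ2N χ2S α DS D2 σ / hFun χ1N χ1S α DS D1 σ) *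
    ((χ1S ^ 2 - (χ1N - σ) ^ 2) / (χ2S ^ 2 - (χ2N - σ) ^ 2))

lemma aux_s (c x : ℝ) (hc : 0 < c) : 0 < √(x ^ 2 + c) ∧ x < √(x ^ 2 + c) ∧ -x < √(x ^ 2 + c) := by
  have h : |x| < √(x ^ 2 + c) := by
    rw [← Real.sqrt_sq_eq_abs]
    exact Real.sqrt_lt_sqrt (sq_nonneg x) (by linarith)
  exact ⟨lt_of_le_of_lt (abs_nonneg x) h, (le_abs_self x).trans_lt h, (neg_le_abs x).trans_lt h⟩

lemma aux_mono (c a b : ℝ) (hc : 0 < c) (hab : a < b) :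
    a / √(a ^ 2 + c) ≤ b / √(b ^ 2 + c) := by
  obtain ⟨pa, a1, a2⟩ := aux_s c a hc
  obtain ⟨pb, b1, b2⟩ := aux_s c b hc
  have ea : √(a ^ 2 + c) ^ 2 = a ^ 2 + c := Real.sq_sqrt (by positivity)
  have eb : √(b ^ 2 + c) ^ 2 = b ^ 2 + c := Real.sq_sqrt (by positivity)
  rw [div_le_div_iff₀ pa pb]
  generalize √(a ^ 2 + c) = u at *
  generalize √(b ^ 2 + c) = v at *
  have k : a * (a + b) ≤ u * (u + v) := by
    have h1 : |a| ≤ u := abs_le.2 ⟨by linarith, by linarith⟩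
    have h2 : |a + b| ≤ u + v := abs_le.2 ⟨by linarith, by linarith⟩
    calc a * (a + b) ≤ |a * (a + b)| := le_abs_self _
      _ = |a| * |a + b| := abs_mul _ _
      _ ≤ u * (u + v) := mul_le_mul h1 h2 (abs_nonneg _) pa.le
  have k2 : (u + v) * (a * v) ≤ (u + v) * (b * u) := by
    have e : (v - u) * (v + u) = (b - a) * (b + a) := by linarith
    have : (u + v) * (b * u) - (u + v) * (a * v)
      = (b - a) * (u * (u + v)) - a * ((v - u) * (v + u)) := by ring
    rw [e] at this
    nlinarith [mul_le_mul_of_nonneg_left k (sub_pos.2 hab).le]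
  exact le_of_mul_le_mul_left k2 (by linarith)

lemma g_mono (N S α DS a b : ℝ) (hS : 0 < S) (hα : 0 < α) (hDS : 0 < DS) (hab : a < b) :
    gFun N S α DS a < gFun N S α DS b := by
  unfold gFun
  have := mul_le_mul_of_nonneg_left (aux_mono (4 * α * DS) a b (by positivity) hab) hS.le
  rw [mul_div_assoc, mul_div_assoc]
  linarith

lemma g_zero (N S α DS a : ℝ) (hS : 0 < S) (hα : 0 < α) (hDS : 0 < DS)
    (h : gFun N S α DS a = 0) : N - S < a ∧ a < N + S := by
  obtain ⟨p, h1, h2⟩ := aux_s (4 * α * DS) a (by positivity)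
  unfold gFun at h
  rw [mul_div_assoc] at h
  have l1 : a / √(a ^ 2 + 4 * α * DS) < 1 := by rw [div_lt_one p]; exact h1
  have l2 : -1 < a / √(a ^ 2 + 4 * α * DS) := by rw [lt_div_iff₀ p]; linarith
  constructor <;> nlinarith

lemma h_neg (N S α DS D a : ℝ) (hD : 0 < D) (hα : 0 < α) (hDS : 0 < DS)
    (h1 : N - S ≤ a) (h2 : a ≤ N + S) : hFun N S α DS D a < 0 := by
  obtain ⟨p, k1, k2⟩ := aux_s (4 * α * DS) a (by positivity)
  unfold hFun
  have e1 : 0 ≤ 2 * DS * ((N + S - a) / D) :=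
    mul_nonneg (by positivity) (div_nonneg (by linarith) hD.le)
  have e2 : 2 * DS * ((N - S - a) / D) ≤ 0 :=
    mul_nonpos_of_nonneg_of_nonpos (by positivity)
      (div_nonpos_of_nonpos_of_nonneg (by linarith) hD.le)
  exact mul_neg_of_neg_of_pos (by linarith) (by linarith)

lemma g_cont (N S α DS : ℝ) (hα : 0 < α) (hDS : 0 < DS) : Continuous (gFun N S α DS) := by
  unfold gFun
  refine Continuous.add (by fun_prop) (Continuous.div (by fun_prop) (by fun_prop) fun x => ?_)
  exact (aux_s (4 * α * DS) x (by positivity)).1.ne'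

lemma h_cont (N S α DS D : ℝ) : Continuous (hFun N S α DS D) := by
  unfold hFun
  fun_prop

/-- Assume `σ_1 < σ_2`, `I_1 ∩ I_2 ≠ ∅`, `σ_2 ∉ I_1 ∩ I_2` and
`χ_2^N − χ_2^S ∉ I_1 ∩ I_2`. Then on the closed interval `[σ_1, χ_1^N + χ_1^S]`:
the quantities `g_2(σ)`, `h_1(σ)`, `h_2(σ)` and `(χ_2^S)² − (σ − χ_2^N)²` never vanish,
the function `G` is continuous and nonnegative, `G(σ_1) = 0`, `G(σ) > 0` for
`σ_1 < σ < χ_1^N + χ_1^S`, and `G` attains a finite maximum `λ* > 0` on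
`[σ_1, χ_1^N + χ_1^S]`. -/
theorem stmt15 (χ1N χ1S χ2N χ2S D1 D2 α DS : ℝ)
    (hχ1S : 0 < χ1S) (hχ2S : 0 < χ2S) (hD1 : 0 < D1) (hD2 : 0 < D2)
    (hα : 0 < α) (hDS : 0 < DS)
    (σ1 σ2 : ℝ)
    (hσ1 : gFun χ1N χ1S α DS σ1 = 0) (hσ2 : gFun χ2N χ2S α DS σ2 = 0)
    (hlt : σ1 < σ2)
    (hne : (Set.Icc (χ1N - χ1S) (χ1N + χ1S) ∩ Set.Icc (χ2N - χ2S) (χ2N + χ2S)).Nonempty)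
    (hs2 : σ2 ∉ Set.Icc (χ1N - χ1S) (χ1N + χ1S) ∩ Set.Icc (χ2N - χ2S) (χ2N + χ2S))
    (ha2 : χ2N - χ2S ∉ Set.Icc (χ1N - χ1S) (χ1N + χ1S) ∩ Set.Icc (χ2N - χ2S) (χ2N + χ2S)) :
    (∀ σ ∈ Set.Icc σ1 (χ1N + χ1S),
        gFun χ2N χ2S α DS σ ≠ 0 ∧ hFun χ1N χ1S α DS D1 σ ≠ 0 ∧
        hFun χ2N χ2S α DS D2 σ ≠ 0 ∧ χ2S ^ 2 - (σ - χ2N) ^ 2 ≠ 0) ∧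
    ContinuousOn (GFun χ1N χ1S χ2N χ2S D1 D2 α DS) (Set.Icc σ1 (χ1N + χ1S)) ∧
    (∀ σ ∈ Set.Icc σ1 (χ1N + χ1S), 0 ≤ GFun χ1N χ1S χ2N χ2S D1 D2 α DS σ) ∧
    GFun χ1N χ1S χ2N χ2S D1 D2 α DS σ1 = 0 ∧
    (∀ σ ∈ Set.Ioo σ1 (χ1N + χ1S), 0 < GFun χ1N χ1S χ2N χ2S D1 D2 α DS σ) ∧
    ∃ lamStar : ℝ, 0 < lamStar ∧
      (∃ σ ∈ Set.Icc σ1 (χ1N + χ1S), GFun χ1N χ1S χ2N χ2S D1 D2 α DS σ = lamStar) ∧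
      ∀ σ ∈ Set.Icc σ1 (χ1N + χ1S), GFun χ1N χ1S χ2N χ2S D1 D2 α DS σ ≤ lamStar := by
  obtain ⟨s1a, s1b⟩ := g_zero _ _ _ _ _ hχ1S hα hDS hσ1
  obtain ⟨s2a, s2b⟩ := g_zero _ _ _ _ _ hχ2S hα hDS hσ2
  have hb : χ1N + χ1S < σ2 := by
    by_contra hc
    exact hs2 ⟨⟨by linarith, by linarith⟩, ⟨by linarith, by linarith⟩⟩
  have ha : χ2N - χ2S < χ1N - χ1S := by
    by_contra hc
    obtain ⟨x, ⟨_, hx1⟩, ⟨hx2, _⟩⟩ := hne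
    exact ha2 ⟨⟨by linarith, by linarith⟩, ⟨by linarith, by linarith⟩⟩
  have G2 : ∀ σ ∈ Set.Icc σ1 (χ1N + χ1S), gFun χ2N χ2S α DS σ < 0 := fun σ hσ => by
    rw [← hσ2]; exact g_mono _ _ _ _ _ _ hχ2S hα hDS (by linarith [hσ.2])
  have H1 : ∀ σ ∈ Set.Icc σ1 (χ1N + χ1S), hFun χ1N χ1S α DS D1 σ < 0 := fun σ hσ =>
    h_neg _ _ _ _ _ _ hD1 hα hDS (by linarith [hσ.1]) hσ.2
  have H2 : ∀ σ ∈ Set.Icc σ1 (χ1N + χ1S), hFun χ2N χ2S α DS D2 σ < 0 := fun σ hσ =>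
    h_neg _ _ _ _ _ _ hD2 hα hDS (by linarith [hσ.1]) (by linarith [hσ.2])
  have Q2 : ∀ σ ∈ Set.Icc σ1 (χ1N + χ1S), 0 < χ2S ^ 2 - (χ2N - σ) ^ 2 := fun σ hσ => by
    have := mul_pos (show 0 < χ2S - (χ2N - σ) by linarith [hσ.1])
      (show 0 < χ2S + (χ2N - σ) by linarith [hσ.2])
    linarith
  have hpos : ∀ σ ∈ Set.Ioo σ1 (χ1N + χ1S), 0 < GFun χ1N χ1S χ2N χ2S D1 D2 α DS σ := by
    intro σ hσ
    have hσ' := Set.Ioo_subset_Icc_self hσ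
    have g1 : 0 < gFun χ1N χ1S α DS σ := by
      rw [← hσ1]; exact g_mono _ _ _ _ _ _ hχ1S hα hDS hσ.1
    have q1 : 0 < χ1S ^ 2 - (χ1N - σ) ^ 2 := by
      have := mul_pos (show 0 < χ1S - (χ1N - σ) by linarith [hσ.1])
        (show 0 < χ1S + (χ1N - σ) by linarith [hσ.2])
      linarith
    unfold GFun
    refine mul_pos (mul_pos (mul_pos_of_neg_of_neg ?_ (div_neg_of_pos_of_neg g1 (G2 σ hσ')))
      (div_pos_of_neg_of_neg (H2 σ hσ') (H1 σ hσ'))) (div_pos q1 (Q2 σ hσ'))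
    have : 0 < χ2S * D2 / (χ1S * D1) := by positivity
    linarith
  have hz1 : GFun χ1N χ1S χ2N χ2S D1 D2 α DS σ1 = 0 := by
    simp [GFun, hσ1]
  have hz2 : GFun χ1N χ1S χ2N χ2S D1 D2 α DS (χ1N + χ1S) = 0 := by
    simp [GFun]
  have hcont : ContinuousOn (GFun χ1N χ1S χ2N χ2S D1 D2 α DS) (Set.Icc σ1 (χ1N + χ1S)) := by
    unfold GFun
    refine ((continuousOn_const.mul
      ((g_cont _ _ _ _ hα hDS).continuousOn.div (g_cont _ _ _ _ hα hDS).continuousOn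
        fun x hx => (G2 x hx).ne)).mul
      ((h_cont _ _ _ _ _).continuousOn.div (h_cont _ _ _ _ _).continuousOn
        fun x hx => (H1 x hx).ne)).mul
      (ContinuousOn.div (by fun_prop) (by fun_prop) fun x hx => (Q2 x hx).ne')
  refine ⟨fun σ hσ => ⟨(G2 σ hσ).ne, (H1 σ hσ).ne, (H2 σ hσ).ne, ?_⟩, hcont, ?_, hz1, hpos, ?_⟩
  · have := Q2 σ hσ
    intro h
    nlinarith
  · intro σ hσ
    rcases eq_or_lt_of_le hσ.1 with h | h
    · rw [← h, hz1]
    rcases eq_or_lt_of_le hσ.2 with h' | h'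
    · rw [h', hz2]
    exact (hpos σ ⟨h, h'⟩).le
  · obtain ⟨m, hm, hmax⟩ := isCompact_Icc.exists_isMaxOn (Set.nonempty_Icc.2 s1b.le) hcont
    have hmid : (σ1 + (χ1N + χ1S)) / 2 ∈ Set.Ioo σ1 (χ1N + χ1S) :=
      ⟨by linarith, by linarith⟩
    exact ⟨_, (hpos _ hmid).trans_le (hmax (Set.Ioo_subset_Icc_self hmid)), ⟨m, hm, rfl⟩,
      fun σ hσ => hmax hσ⟩
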